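/- Let X be a Banach space, n ∈ ℕ, α ∈ (0,1], and set N = 2^{n+1} − 1. Suppose x₁,…,x_N are vectors in the closed unit ball of X satisfying, for every j ∈ {1,…,N−1} and all real coefficients a₁,…,a_N, the inequality ‖Σ_{i=1}^N a_i x_i‖ ≥ α·(|Σ_{i=1}^j a_i| + |Σ_{i=j+1}^N a_i|). Then there exists a map F : T_n → X such that α·d(t₁,t₂) ≤ ‖F(t₁) − F(t₂)‖ ≤ d(t₁,t₂) for all t₁, t₂ ∈ T_n; in particular T_n admits a bilipschitz embedding into X with distortion at most 1/α. -/

import Mathlib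

noncomputable section

/-- The length of the longest common initial segment of two `{0,1}`-sequences. -/
def lcp : List Bool → List Bool → ℕ
  | a :: s, b :: t => if a = b then lcp s t + 1 else 0
  | _, _ => 0

/-- The tree distance `d(s,t) = |s| + |t| − 2ℓ(s,t)` on finite `{0,1}`-sequences. -/
def treeDist (s t : List Bool) : ℝ :=
  (s.length : ℝ) + (t.length : ℝ) - 2 * (lcp s t : ℝ)

/-- The binary tree of depth `n`: all `{0,1}`-sequences of length at most `n`. -/
def BinTree (n : ℕ) := {l : List Bool // l.length ≤ n}

/-- The inorder positions, starting at offset `o`, of the initial segments of a vertex of the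
binary tree of depth `n`. -/
def inorderPath : ℕ → ℕ → List Bool → Finset ℕ
  | n, o, [] => {o + (2 ^ n - 1)}
  | 0, _, _ :: _ => ∅
  | n + 1, o, b :: l =>
    insert (o + (2 ^ (n + 1) - 1)) (inorderPath n (if b then o + 2 ^ (n + 1) else o) l)

lemma inorderPath_nil (n o : ℕ) : inorderPath n o [] = {o + (2 ^ n - 1)} := by
  cases n <;> rfl

lemma inorderPath_cons (n o : ℕ) (b : Bool) (l : List Bool) :
    inorderPath (n + 1) o (b :: l) =
      insert (o + (2 ^ (n + 1) - 1))
        (inorderPath n (if b then o + 2 ^ (n + 1) else o) l) := rfl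

lemma root_mem_inorderPath {n : ℕ} (o : ℕ) {l : List Bool} (hl : l.length ≤ n) :
    o + (2 ^ n - 1) ∈ inorderPath n o l := by
  rcases l with _ | ⟨b, l⟩
  · simp [inorderPath_nil]
  · rcases n with _ | n
    · simp at hl
    · simp [inorderPath_cons]

lemma bounds_of_mem_inorderPath {n : ℕ} : ∀ {o : ℕ} {l : List Bool}, l.length ≤ n →
    ∀ {i : ℕ}, i ∈ inorderPath n o l → o ≤ i ∧ i + 1 < o + 2 ^ (n + 1) := by
  induction n with
  | zero =>
    intro o l hl i hi
    obtain rfl : l = [] := by simpa using hl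
    simp [inorderPath_nil] at hi
    omega
  | succ n ih =>
    intro o l hl i hi
    have hpos : 0 < 2 ^ n := by positivity
    have h1 : 2 ^ (n + 1) = 2 * 2 ^ n := by ring
    have h2 : 2 ^ (n + 1 + 1) = 4 * 2 ^ n := by ring
    rcases l with _ | ⟨b, l⟩
    · simp only [inorderPath_nil, Finset.mem_singleton] at hi
      omega
    · rw [inorderPath_cons, Finset.mem_insert] at hi
      rcases hi with rfl | hi
      · omega
      · have := ih (by simpa using hl) hi
        cases b <;> simp at this <;> omega

lemma root_notMem_inorderPath_child {n : ℕ} (o : ℕ) (b : Bool) {l : List Bool}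
    (hl : l.length ≤ n) :
    o + (2 ^ (n + 1) - 1) ∉ inorderPath n (if b then o + 2 ^ (n + 1) else o) l := by
  intro h
  have := bounds_of_mem_inorderPath hl h
  have hpos : 0 < 2 ^ (n + 1) := by positivity
  cases b <;> simp at this <;> omega

lemma card_inorderPath {n : ℕ} : ∀ (o : ℕ) {l : List Bool}, l.length ≤ n →
    (inorderPath n o l).card = l.length + 1 := by
  induction n with
  | zero =>
    intro o l hl
    obtain rfl : l = [] := by simpa using hl
    simp [inorderPath_nil]
  | succ n ih =>
    intro o l hl
    rcases l with _ | ⟨b, l⟩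
    · simp [inorderPath_nil]
    · have hl' : l.length ≤ n := by simpa using hl
      rw [inorderPath_cons, Finset.card_insert_of_notMem (root_notMem_inorderPath_child o b hl'),
        ih _ hl', List.length_cons]

lemma inorderPath_child_lt {n o i k : ℕ} {s t : List Bool} (hs : s.length ≤ n)
    (ht : t.length ≤ n) (hi : i ∈ inorderPath n o s)
    (hk : k ∈ inorderPath n (o + 2 ^ (n + 1)) t) :
    i < o + (2 ^ (n + 1) - 1) ∧ o + (2 ^ (n + 1) - 1) < k := by
  have h1 := bounds_of_mem_inorderPath hs hi
  have h2 := bounds_of_mem_inorderPath ht hk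
  omega

lemma card_inorderPath_inter {n : ℕ} : ∀ (o : ℕ) {s t : List Bool}, s.length ≤ n →
    t.length ≤ n → (inorderPath n o s ∩ inorderPath n o t).card = lcp s t + 1 := by
  induction n with
  | zero =>
    intro o s t hs ht
    obtain rfl : s = [] := by simpa using hs
    obtain rfl : t = [] := by simpa using ht
    simp [inorderPath_nil, lcp]
  | succ n ih =>
    intro o s t hs ht
    rcases s with _ | ⟨a, s⟩
    · rw [inorderPath_nil, Finset.singleton_inter_of_mem (root_mem_inorderPath o ht)]
      simp [lcp]
    rcases t with _ | ⟨b, t⟩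
    · rw [inorderPath_nil, Finset.inter_singleton_of_mem (root_mem_inorderPath o hs)]
      simp [lcp]
    have hs' : s.length ≤ n := by simpa using hs
    have ht' : t.length ≤ n := by simpa using ht
    rw [inorderPath_cons, inorderPath_cons, ← Finset.insert_inter_distrib,
      Finset.card_insert_of_notMem fun h =>
        root_notMem_inorderPath_child o a hs' (Finset.mem_inter.1 h).1]
    by_cases hab : a = b
    · subst hab
      rw [ih _ hs' ht']
      simp [lcp]
    · simp only [lcp, hab, if_false, Nat.zero_add, Nat.add_eq_right, Finset.card_eq_zero]
      rw [← Finset.disjoint_iff_inter_eq_empty, Finset.disjoint_left]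
      intro i hi hk
      rcases a <;> rcases b <;> simp at hab hi hk
      · have := inorderPath_child_lt hs' ht' hi hk
        omega
      · have := inorderPath_child_lt ht' hs' hk hi
        omega

/-- Two finite sets of natural numbers are separated by a threshold. -/
def SeparatedAt (j : ℕ) (A B : Finset ℕ) : Prop :=
  (∀ i ∈ A, i < j) ∧ ∀ i ∈ B, j ≤ i

lemma inorderPath_sdiff_separated {n : ℕ} : ∀ (o : ℕ) {s t : List Bool}, s.length ≤ n →
    t.length ≤ n →
    inorderPath n o s \ inorderPath n o t = ∅ ∨ inorderPath n o t \ inorderPath n o s = ∅ ∨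
    ∃ j, SeparatedAt j (inorderPath n o s \ inorderPath n o t)
        (inorderPath n o t \ inorderPath n o s) ∨
      SeparatedAt j (inorderPath n o t \ inorderPath n o s)
        (inorderPath n o s \ inorderPath n o t) := by
  induction n with
  | zero =>
    intro o s t hs ht
    obtain rfl : s = [] := by simpa using hs
    obtain rfl : t = [] := by simpa using ht
    simp
  | succ n ih =>
    intro o s t hs ht
    rcases s with _ | ⟨a, s⟩
    · left
      rw [inorderPath_nil, Finset.sdiff_eq_empty_iff_subset, Finset.singleton_subset_iff]
      exact root_mem_inorderPath o ht
    rcases t with _ | ⟨b, t⟩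
    · right; left
      rw [inorderPath_nil, Finset.sdiff_eq_empty_iff_subset, Finset.singleton_subset_iff]
      exact root_mem_inorderPath o hs
    have hs' : s.length ≤ n := by simpa using hs
    have ht' : t.length ≤ n := by simpa using ht
    have key : ∀ {c d : Bool} {u v : List Bool}, u.length ≤ n →
        inorderPath (n + 1) o (c :: u) \ inorderPath (n + 1) o (d :: v) =
          inorderPath n (if c then o + 2 ^ (n + 1) else o) u \
            inorderPath n (if d then o + 2 ^ (n + 1) else o) v := by
      intro c d u v hu
      rw [inorderPath_cons, inorderPath_cons, Finset.insert_sdiff_insert,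
        Finset.sdiff_insert_of_notMem (root_notMem_inorderPath_child o c hu)]
    rw [key hs', key ht']
    by_cases hab : a = b
    · subst hab
      exact ih _ hs' ht'
    · right; right
      refine ⟨o + (2 ^ (n + 1) - 1), ?_⟩
      have hlt : ∀ {l : List Bool}, l.length ≤ n → ∀ i ∈ inorderPath n o l,
          i < o + (2 ^ (n + 1) - 1) := fun hl i hi => by
        have := bounds_of_mem_inorderPath hl hi
        omega
      have hge : ∀ {l : List Bool}, l.length ≤ n → ∀ i ∈ inorderPath n (o + 2 ^ (n + 1)) l,
          o + (2 ^ (n + 1) - 1) ≤ i := fun hl i hi => by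
        have := bounds_of_mem_inorderPath hl hi
        omega
      rcases a <;> rcases b <;> simp at hab
      · left
        exact ⟨fun i hi => hlt hs' i (by simpa using (Finset.mem_sdiff.1 hi).1),
          fun i hi => hge ht' i (by simpa using (Finset.mem_sdiff.1 hi).1)⟩
      · right
        exact ⟨fun i hi => hlt ht' i (by simpa using (Finset.mem_sdiff.1 hi).1),
          fun i hi => hge hs' i (by simpa using (Finset.mem_sdiff.1 hi).1)⟩

lemma treeDist_eq_card_sdiff {n : ℕ} (o : ℕ) {s t : List Bool} (hs : s.length ≤ n)
    (ht : t.length ≤ n) :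
    treeDist s t = ((inorderPath n o s \ inorderPath n o t).card : ℝ) +
      ((inorderPath n o t \ inorderPath n o s).card : ℝ) := by
  have h1 := Finset.card_sdiff_add_card_inter (inorderPath n o s) (inorderPath n o t)
  have h2 := Finset.card_sdiff_add_card_inter (inorderPath n o t) (inorderPath n o s)
  rw [card_inorderPath_inter o hs ht, card_inorderPath o hs] at h1
  rw [Finset.inter_comm, card_inorderPath_inter o hs ht, card_inorderPath o ht] at h2
  have h1' : ((inorderPath n o s \ inorderPath n o t).card : ℝ) + (lcp s t + 1) =
    s.length + 1 := by exact_mod_cast h1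
  have h2' : ((inorderPath n o t \ inorderPath n o s).card : ℝ) + (lcp s t + 1) =
    t.length + 1 := by exact_mod_cast h2
  unfold treeDist
  linarith

section Flat

variable {X : Type*} [NormedAddCommGroup X] [NormedSpace ℝ X]

/-- James' flatness condition for the first `N` terms of a sequence. -/
def IsFlat (α : ℝ) (N : ℕ) (x : ℕ → X) : Prop :=
  ∀ j : ℕ, 1 ≤ j → j ≤ N - 1 → ∀ a : ℕ → ℝ,
    α * (|∑ i ∈ Finset.range j, a i| + |∑ i ∈ Finset.Ico j N, a i|) ≤
      ‖∑ i ∈ Finset.range N, a i • x i‖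

lemma IsFlat.card_le_norm_sum {α : ℝ} (hα : 0 ≤ α) {N : ℕ} (hN : 2 ≤ N) {x : ℕ → X}
    (h : IsFlat α N x) {A : Finset ℕ} (hA : A ⊆ Finset.range N) :
    α * A.card ≤ ‖∑ i ∈ A, x i‖ := by
  have h1 := h 1 le_rfl (by omega) (fun i => if i ∈ A then 1 else 0)
  have h2 := abs_add_le (∑ i ∈ Finset.range 1, if i ∈ A then (1 : ℝ) else 0)
    (∑ i ∈ Finset.Ico 1 N, if i ∈ A then (1 : ℝ) else 0)
  rw [Finset.sum_range_add_sum_Ico _ (by omega)] at h2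
  simp only [ite_smul, one_smul, zero_smul, Finset.sum_ite_mem,
    Finset.inter_eq_right.2 hA] at h1 h2
  refine le_trans (mul_le_mul_of_nonneg_left ?_ hα) h1
  simpa using h2

lemma IsFlat.card_add_card_le_norm_sub {α : ℝ} {N j : ℕ} (hj₁ : 1 ≤ j) (hj₂ : j ≤ N - 1)
    {x : ℕ → X} (h : IsFlat α N x) {A B : Finset ℕ} (hA : A ⊆ Finset.range N)
    (hB : B ⊆ Finset.range N) (hAB : SeparatedAt j A B) :
    α * (A.card + B.card) ≤ ‖∑ i ∈ A, x i - ∑ i ∈ B, x i‖ := by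
  have h1 := h j hj₁ hj₂ (fun i => (if i ∈ A then 1 else 0) - (if i ∈ B then 1 else 0))
  have hA₁ : Finset.range j ∩ A = A :=
    Finset.inter_eq_right.2 fun i hi => Finset.mem_range.2 (hAB.1 i hi)
  have hB₁ : Finset.range j ∩ B = ∅ := by
    ext i
    have := hAB.2 i
    simp
    grind
  have hA₂ : Finset.Ico j N ∩ A = ∅ := by
    ext i
    have := hAB.1 i
    simp
    grind
  have hB₂ : Finset.Ico j N ∩ B = B :=
    Finset.inter_eq_right.2 fun i hi =>
      Finset.mem_Ico.2 ⟨hAB.2 i hi, Finset.mem_range.1 (hB hi)⟩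
  simp only [sub_smul, ite_smul, one_smul, zero_smul, Finset.sum_sub_distrib,
    Finset.sum_ite_mem, hA₁, hB₁, hA₂, hB₂, Finset.inter_eq_right.2 hA,
    Finset.inter_eq_right.2 hB] at h1
  simpa using h1

lemma IsFlat.card_add_card_le_norm_sub_of_nonempty {α : ℝ} {N j : ℕ} {x : ℕ → X}
    (h : IsFlat α N x) {A B : Finset ℕ} (hA : A ⊆ Finset.range N) (hB : B ⊆ Finset.range N)
    (hA₀ : A.Nonempty) (hB₀ : B.Nonempty) (hAB : SeparatedAt j A B) :
    α * (A.card + B.card) ≤ ‖∑ i ∈ A, x i - ∑ i ∈ B, x i‖ := by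
  obtain ⟨i, hi⟩ := hA₀
  obtain ⟨k, hk⟩ := hB₀
  have h1 := hAB.1 i hi
  have h2 := hAB.2 k hk
  have h3 := Finset.mem_range.1 (hB hk)
  exact h.card_add_card_le_norm_sub (by omega) (by omega) hA hB hAB

end Flat

/-- Bourgain's embedding of the binary tree: from a sequence of `N = 2^{n+1} − 1` vectors
in the unit ball satisfying James' flatness condition with constant `α`, one obtains a
map of `T_n` into `X` with `α·d(t₁,t₂) ≤ ‖F t₁ − F t₂‖ ≤ d(t₁,t₂)`. -/
theorem tree_embedding_from_flat_sequence
    (X : Type) [NormedAddCommGroup X] [NormedSpace ℝ X] [CompleteSpace X]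
    (n : ℕ) (α : ℝ) (hα₀ : 0 < α) (hα₁ : α ≤ 1) (N : ℕ) (hN : N = 2 ^ (n + 1) - 1)
    (x : ℕ → X) (hx : ∀ i < N, ‖x i‖ ≤ 1)
    (hflat : ∀ j : ℕ, 1 ≤ j → j ≤ N - 1 → ∀ a : ℕ → ℝ,
      α * (|∑ i ∈ Finset.range j, a i| + |∑ i ∈ Finset.Ico j N, a i|) ≤
        ‖∑ i ∈ Finset.range N, a i • x i‖) :
    ∃ F : BinTree n → X, ∀ t₁ t₂ : BinTree n,
      α * treeDist t₁.1 t₂.1 ≤ ‖F t₁ - F t₂‖ ∧ ‖F t₁ - F t₂‖ ≤ treeDist t₁.1 t₂.1 := by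
  have hpow : 0 < 2 ^ n := by positivity
  have hpow' : 2 ^ (n + 1) = 2 * 2 ^ n := by ring
  have hsub : ∀ t : BinTree n, inorderPath n 0 t.1 ⊆ Finset.range N := fun t i hi => by
    have := bounds_of_mem_inorderPath t.2 hi
    rw [Finset.mem_range]
    omega
  have hflat' : IsFlat α N x := hflat
  rcases Nat.eq_zero_or_pos n with rfl | hn
  · refine ⟨fun _ => 0, fun t₁ t₂ => ?_⟩
    have h : ∀ t : BinTree 0, t.1 = [] := fun t => by simpa using t.2
    simp [h, treeDist, lcp]
  have hN₂ : 2 ≤ N := by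
    have := Nat.one_lt_two_pow hn.ne'
    omega
  refine ⟨fun t => ∑ i ∈ inorderPath n 0 t.1, x i, fun t₁ t₂ => ?_⟩
  have hcard := treeDist_eq_card_sdiff 0 t₁.2 t₂.2
  have hsep := inorderPath_sdiff_separated 0 t₁.2 t₂.2
  have hA : inorderPath n 0 t₁.1 \ inorderPath n 0 t₂.1 ⊆ Finset.range N :=
    Finset.sdiff_subset.trans (hsub t₁)
  have hB : inorderPath n 0 t₂.1 \ inorderPath n 0 t₁.1 ⊆ Finset.range N :=
    Finset.sdiff_subset.trans (hsub t₂)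
  beta_reduce
  rw [← Finset.sum_sdiff_sub_sum_sdiff, hcard]
  generalize inorderPath n 0 t₁.1 \ inorderPath n 0 t₂.1 = A at *
  generalize inorderPath n 0 t₂.1 \ inorderPath n 0 t₁.1 = B at *
  have hnorm : ∀ C ⊆ Finset.range N, ‖∑ i ∈ C, x i‖ ≤ C.card := fun C hC => by
    simpa using norm_sum_le_of_le C fun i hi => hx i (Finset.mem_range.1 (hC hi))
  refine ⟨?_, (norm_sub_le _ _).trans (add_le_add (hnorm A hA) (hnorm B hB))⟩
  rcases A.eq_empty_or_nonempty with rfl | hA₀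
  · simpa using hflat'.card_le_norm_sum hα₀.le hN₂ hB
  rcases B.eq_empty_or_nonempty with rfl | hB₀
  · simpa using hflat'.card_le_norm_sum hα₀.le hN₂ hA
  rcases hsep with h | h | ⟨j, h | h⟩
  · exact absurd h hA₀.ne_empty
  · exact absurd h hB₀.ne_empty
  · exact hflat'.card_add_card_le_norm_sub_of_nonempty hA hB hA₀ hB₀ h
  · rw [norm_sub_rev, add_comm]
    exact hflat'.card_add_card_le_norm_sub_of_nonempty hB hA hB₀ hA₀ h
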